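/- Every context-free matrix language of finite index is generated by some capacity-bounded phrase structure grammar (Ginsburg–Spanier), i.e., MAT_fin ⊆ GS_cb. -/

import Mathlib

/-! Common definitions: symbols, context-free grammars, Ginsburg–Spanier phrase
structure grammars, capacity-bounded derivations, matrix/vector grammars,
finite index, cf Petri nets with place capacities, and language families. -/

inductive Symb (N T : Type) where
  | nt : N → Symb N T
  | tm : T → Symb N T
deriving DecidableEq

namespace CapGram

variable {N T Δ α : Type}

open Classical in
/-- Number of occurrences of the nonterminal `A` in a sentential form. -/
noncomputable def symCount (A : N) : List (Symb N T) → ℕ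
  | [] => 0
  | Symb.nt B :: r => (if B = A then 1 else 0) + symCount A r
  | Symb.tm _ :: r => symCount A r

/-- Total number of nonterminal occurrences in a sentential form. -/
def ntCount : List (Symb N T) → ℕ
  | [] => 0
  | Symb.nt _ :: r => 1 + ntCount r
  | Symb.tm _ :: r => ntCount r

/-- The sentential form `w` respects the capacity function `κ`. -/
def CapOK (κ : N → ℕ) (w : List (Symb N T)) : Prop :=
  ∀ A : N, symCount A w ≤ κ A

/-- A context-free grammar (rules are pairs of a nonterminal and a word). -/
structure CFG (N T : Type) where
  start : N
  rules : Finset (N × List (Symb N T))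

/-- Application of a single context-free rule. -/
def applyRule (r : N × List (Symb N T)) (u v : List (Symb N T)) : Prop :=
  ∃ x y : List (Symb N T), u = x ++ Symb.nt r.1 :: y ∧ v = x ++ r.2 ++ y

def CFG.Step (G : CFG N T) (u v : List (Symb N T)) : Prop :=
  ∃ r ∈ G.rules, applyRule r u v

/-- A derivation step both of whose sentential forms respect the capacity. -/
def CFG.CapStep (G : CFG N T) (κ : N → ℕ) (u v : List (Symb N T)) : Prop :=
  G.Step u v ∧ CapOK κ u ∧ CapOK κ v

/-- A derivation step both of whose sentential forms have at most `k`
nonterminal occurrences in total. -/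
def CFG.IdxStep (G : CFG N T) (k : ℕ) (u v : List (Symb N T)) : Prop :=
  G.Step u v ∧ ntCount u ≤ k ∧ ntCount v ≤ k

/-- The (unrestricted) language of a context-free grammar. -/
def CFG.Lang (G : CFG N T) : Set (List T) :=
  { w | Relation.ReflTransGen G.Step [Symb.nt G.start] (w.map Symb.tm) }

/-- The language of the capacity-bounded grammar `(G, κ)`. -/
def CFG.CapLang (G : CFG N T) (κ : N → ℕ) : Set (List T) :=
  { w | Relation.ReflTransGen (G.CapStep κ) [Symb.nt G.start] (w.map Symb.tm) }

/-- Words with a derivation of index at most `k`. -/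
def CFG.FinLang (G : CFG N T) (k : ℕ) : Set (List T) :=
  { w | Relation.ReflTransGen (G.IdxStep k) [Symb.nt G.start] (w.map Symb.tm) }

/-- A phrase structure grammar due to Ginsburg and Spanier: the left-hand side
of a rule is a nonempty word of nonterminals, encoded as head and tail. -/
structure GSG (N T : Type) where
  start : N
  rules : Finset ((N × List N) × List (Symb N T))

def GSG.Step (G : GSG N T) (u v : List (Symb N T)) : Prop :=
  ∃ r ∈ G.rules, ∃ x y : List (Symb N T),
    u = x ++ (r.1.1 :: r.1.2).map Symb.nt ++ y ∧ v = x ++ r.2 ++ y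

def GSG.CapStep (G : GSG N T) (κ : N → ℕ) (u v : List (Symb N T)) : Prop :=
  G.Step u v ∧ CapOK κ u ∧ CapOK κ v

def GSG.Lang (G : GSG N T) : Set (List T) :=
  { w | Relation.ReflTransGen G.Step [Symb.nt G.start] (w.map Symb.tm) }

def GSG.CapLang (G : GSG N T) (κ : N → ℕ) : Set (List T) :=
  { w | Relation.ReflTransGen (G.CapStep κ) [Symb.nt G.start] (w.map Symb.tm) }

/-- Derivations labeled by their sequence of context-free rules, where every
sentential form (including the first and last) satisfies the invariant `P`. -/
inductive DerivP (P : List (Symb N T) → Prop) :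
    List (N × List (Symb N T)) → List (Symb N T) → List (Symb N T) → Prop
  | nil (u : List (Symb N T)) : P u → DerivP P [] u u
  | cons {r π u v w} : P u → applyRule r u v → DerivP P π v w →
      DerivP P (r :: π) u w

/-- A matrix grammar: a finite set of matrices (sequences of cf rules). -/
structure MG (N T : Type) where
  start : N
  mats : Finset (List (N × List (Symb N T)))

/-- Matrix language: rule sequences are concatenations of matrices. -/
def MG.Lang (G : MG N T) : Set (List T) :=
  { w | ∃ ms : List (List (N × List (Symb N T))),
      (∀ m ∈ ms, m ∈ G.mats) ∧
      DerivP (fun _ => True) ms.flatten [Symb.nt G.start] (w.map Symb.tm) }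

/-- Words with a matrix derivation of index at most `k`. -/
def MG.FinLang (G : MG N T) (k : ℕ) : Set (List T) :=
  { w | ∃ ms : List (List (N × List (Symb N T))),
      (∀ m ∈ ms, m ∈ G.mats) ∧
      DerivP (fun u => ntCount u ≤ k) ms.flatten [Symb.nt G.start] (w.map Symb.tm) }

/-- `Shuffle ms π`: `π` is an interleaving (shuffle) of the lists in `ms`. -/
inductive Shuffle : List (List α) → List α → Prop
  | nil (ms : List (List α)) : (∀ l ∈ ms, l = []) → Shuffle ms []
  | cons {ms₁ : List (List α)} {l : List α} {ms₂ : List (List α)} {π : List α}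
      (a : α) : Shuffle (ms₁ ++ l :: ms₂) π →
      Shuffle (ms₁ ++ (a :: l) :: ms₂) (a :: π)

/-- A vector grammar: like a matrix grammar, but derivations use shuffles. -/
structure VG (N T : Type) where
  start : N
  mats : Finset (List (N × List (Symb N T)))

def VG.Lang (G : VG N T) : Set (List T) :=
  { w | ∃ ms π, (∀ m ∈ ms, m ∈ G.mats) ∧ Shuffle ms π ∧
      DerivP (fun _ => True) π [Symb.nt G.start] (w.map Symb.tm) }

def VG.CapLang (G : VG N T) (κ : N → ℕ) : Set (List T) :=
  { w | ∃ ms π, (∀ m ∈ ms, m ∈ G.mats) ∧ Shuffle ms π ∧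
      DerivP (CapOK κ) π [Symb.nt G.start] (w.map Symb.tm) }

def VG.FinLang (G : VG N T) (k : ℕ) : Set (List T) :=
  { w | ∃ ms π, (∀ m ∈ ms, m ∈ G.mats) ∧ Shuffle ms π ∧
      DerivP (fun u => ntCount u ≤ k) π [Symb.nt G.start] (w.map Symb.tm) }

/-! cf Petri nets: places are in bijection with the nonterminals, transitions
with the rules; firing the transition of rule `A → α` consumes one token from
the place of `A` and adds `|α|_X` tokens to the place of each nonterminal `X`. -/

open Classical in
/-- Firing of the transition corresponding to rule `r`, turning marking `μ`
into marking `μ'`. -/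
noncomputable def ruleFire (r : N × List (Symb N T)) (μ μ' : N → ℕ) : Prop :=
  1 ≤ μ r.1 ∧ ∀ A, μ' A = μ A - (if A = r.1 then 1 else 0) + symCount A r.2

/-- Occurrence sequences of the cf Petri net of `G`, all of whose markings
(including initial and final) satisfy the validity predicate `P`. -/
inductive FireSeqP (G : CFG N T) (P : (N → ℕ) → Prop) :
    List (N × List (Symb N T)) → (N → ℕ) → (N → ℕ) → Prop
  | nil (μ : N → ℕ) : P μ → FireSeqP G P [] μ μ
  | cons {r π μ μ' μ''} : r ∈ G.rules → P μ → ruleFire r μ μ' →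
      FireSeqP G P π μ' μ'' → FireSeqP G P (r :: π) μ μ''

open Classical in
/-- The initial marking: one token on the place of the start symbol. -/
noncomputable def initMark (G : CFG N T) : N → ℕ :=
  fun A => if A = G.start then 1 else 0

/-- The language of `G` controlled by its cf Petri net restricted to markings
satisfying `P` (e.g. a place capacity constraint). -/
def CFG.PNLang (G : CFG N T) (P : (N → ℕ) → Prop) : Set (List T) :=
  { w | ∃ π μ, DerivP (fun _ => True) π [Symb.nt G.start] (w.map Symb.tm) ∧
      FireSeqP G P π (initMark G) μ }

/-! Language families over a terminal alphabet `T`. -/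

/-- Context-free languages of finite index. -/
def CFfin (T : Type) : Set (Set (List T)) :=
  { L | ∃ (N : Type) (_ : Fintype N) (G : CFG N T) (k : ℕ),
      L = G.Lang ∧ G.Lang ⊆ G.FinLang k }

/-- Languages of capacity-bounded context-free grammars. -/
def CFcb (T : Type) : Set (Set (List T)) :=
  { L | ∃ (N : Type) (_ : Fintype N) (G : CFG N T) (κ : N → ℕ),
      L = G.CapLang κ }

/-- Languages of capacity-bounded Ginsburg–Spanier phrase structure grammars. -/
def GScb (T : Type) : Set (Set (List T)) :=
  { L | ∃ (N : Type) (_ : Fintype N) (G : GSG N T) (κ : N → ℕ),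
      L = G.CapLang κ }

/-- Matrix languages of finite index. -/
def MATfin (T : Type) : Set (Set (List T)) :=
  { L | ∃ (N : Type) (_ : Fintype N) (G : MG N T) (k : ℕ),
      L = G.Lang ∧ G.Lang ⊆ G.FinLang k }

/-- Capacity-bounded vector languages (erasing rules allowed). -/
def Vcb (T : Type) : Set (Set (List T)) :=
  { L | ∃ (N : Type) (_ : Fintype N) (G : VG N T) (κ : N → ℕ),
      L = G.CapLang κ }

/-- Vector languages of finite index (erasing rules allowed). -/
def Vfin (T : Type) : Set (Set (List T)) :=
  { L | ∃ (N : Type) (_ : Fintype N) (G : VG N T) (k : ℕ),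
      L = G.Lang ∧ G.Lang ⊆ G.FinLang k }

/-- Languages of grammars controlled by cf Petri nets with place capacities. -/
def PNcap (T : Type) : Set (Set (List T)) :=
  { L | ∃ (N : Type) (_ : Fintype N) (G : CFG N T) (κ : N → ℕ),
      L = G.PNLang (fun μ => ∀ A, μ A ≤ κ A) }


/-! Nonterminal words and relabelings of sentential forms. -/

/-- The word of nonterminals occurring in a sentential form. -/
def ntList : List (Symb N T) → List N
  | [] => []
  | Symb.nt A :: r => A :: ntList r
  | Symb.tm _ :: r => ntList r

/-- Relabel the nonterminals of a symbol. -/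
def mapSymb {M N T : Type} (f : M → N) : Symb M T → Symb N T
  | Symb.nt A => Symb.nt (f A)
  | Symb.tm a => Symb.tm a

@[simp] theorem ntList_nil : ntList ([] : List (Symb N T)) = [] := rfl

@[simp] theorem ntList_nt (A : N) (u : List (Symb N T)) :
    ntList (Symb.nt A :: u) = A :: ntList u := rfl

@[simp] theorem ntList_tm (a : T) (u : List (Symb N T)) :
    ntList (Symb.tm a :: u) = ntList u := rfl

@[simp] theorem ntList_append (u v : List (Symb N T)) :
    ntList (u ++ v) = ntList u ++ ntList v := by
  induction u with
  | nil => rfl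
  | cons s u ih => cases s <;> simp [ih]

@[simp] theorem ntList_map_mapSymb {M : Type} (f : M → N) (u : List (Symb M T)) :
    ntList (u.map (mapSymb f)) = (ntList u).map f := by
  induction u with
  | nil => rfl
  | cons s u ih => cases s <;> simp [ih, mapSymb]

@[simp] theorem ntList_map_nt (l : List N) :
    ntList (l.map (Symb.nt : N → Symb N T)) = l := by
  induction l with
  | nil => rfl
  | cons s u ih => simp [ih]

@[simp] theorem ntList_map_tm (w : List T) :
    ntList (w.map (Symb.tm : T → Symb N T)) = [] := by
  induction w with
  | nil => rfl
  | cons s u ih => simp [ih]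

theorem mem_ntList {A : N} {u : List (Symb N T)} : A ∈ ntList u ↔ Symb.nt A ∈ u := by
  induction u with
  | nil => simp
  | cons s u ih => cases s <;> simp [ih]

theorem ntCount_eq_length (u : List (Symb N T)) : ntCount u = (ntList u).length := by
  induction u with
  | nil => rfl
  | cons s u ih => cases s <;> simp [ntCount, ih, Nat.add_comm]

theorem exists_map_tm_of_ntList_eq_nil {u : List (Symb N T)} (h : ntList u = []) :
    ∃ w : List T, u = w.map Symb.tm := by
  induction u with
  | nil => exact ⟨[], rfl⟩
  | cons s u ih =>
    cases s with
    | nt A => simp at h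
    | tm a =>
      obtain ⟨w, rfl⟩ := ih (by simpa using h)
      exact ⟨a :: w, rfl⟩

theorem map_mapSymb_map_tm {M : Type} (f : M → N) (w : List T) :
    (w.map Symb.tm).map (mapSymb f) = w.map Symb.tm := by
  simp [Function.comp_def, mapSymb]

theorem eq_map_tm_of_map_mapSymb {M : Type} {f : M → N} {u : List (Symb M T)} {w : List T}
    (h : u.map (mapSymb f) = w.map Symb.tm) : u = w.map Symb.tm := by
  have h0 : (ntList u).map f = [] := by
    rw [← ntList_map_mapSymb, h, ntList_map_tm]
  obtain ⟨w', rfl⟩ := exists_map_tm_of_ntList_eq_nil (List.map_eq_nil_iff.mp h0)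
  rw [map_mapSymb_map_tm] at h
  rw [List.map_injective_iff.mpr (fun _ _ h => Symb.tm.inj h) h]

theorem map_mapSymb_eq_split {M : Type} {f : M → N} {u : List (Symb M T)} {A : N}
    {x y : List (Symb N T)} (h : u.map (mapSymb f) = x ++ Symb.nt A :: y) :
    ∃ x' a y', u = x' ++ Symb.nt a :: y' ∧ x'.map (mapSymb f) = x ∧ f a = A ∧
      y'.map (mapSymb f) = y := by
  obtain ⟨x', v, rfl, hx, hv⟩ := List.map_eq_append_iff.mp h
  obtain ⟨s, y', rfl, hs, hy⟩ := List.map_eq_cons_iff.mp hv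
  cases s with
  | nt a => exact ⟨x', a, y', rfl, hx, Symb.nt.inj hs, hy⟩
  | tm a => cases hs

theorem capOK_one_iff {u : List (Symb N T)} : CapOK (fun _ => 1) u ↔ (ntList u).Nodup := by
  classical
  have h : ∀ A, symCount A u = (ntList u).count A := by
    intro A
    induction u with
    | nil => rfl
    | cons s u ih =>
      cases s with
      | nt B => simp only [symCount, ntList_nt, List.count_cons, ih, beq_iff_eq]; split_ifs <;> omega
      | tm a => simpa [symCount] using ih
  simp [CapOK, List.nodup_iff_count_le_one, h]

/-- Words with finite fibers of letters have finite fibers. -/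
theorem finite_map_fiber {β γ : Type} (f : β → γ) (hf : ∀ c, {b | f b = c}.Finite) (l : List γ) :
    {l' : List β | l'.map f = l}.Finite := by
  induction l with
  | nil => exact (Set.finite_singleton []).subset (by intro l' h; simpa using h)
  | cons c l ih =>
    refine ((hf c).image2 List.cons ih).subset ?_
    intro l' h
    obtain ⟨b, l'', rfl, hb, hl⟩ := List.map_eq_cons_iff.mp h
    exact ⟨b, hb, l'', hl, rfl⟩

theorem finite_map_mapSymb_fiber {M : Type} [Finite M] (f : M → N) (u : List (Symb N T)) :
    {v : List (Symb M T) | v.map (mapSymb f) = u}.Finite := by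
  refine finite_map_fiber _ (fun c => ?_) u
  cases c with
  | nt A =>
    refine (Set.finite_range (Symb.nt : M → Symb M T)).subset ?_
    rintro (a | a) h
    · exact ⟨a, rfl⟩
    · cases h
  | tm a =>
    refine (Set.finite_singleton (Symb.tm a)).subset ?_
    rintro (b | b) h
    · cases h
    · cases h; rfl

/-! Grammars with forbidding contexts in which every nonterminal has capacity one. -/

/-- A grammar with context-free rules, each of which carries a set of nonterminals that must not
occur in the context of the rewritten symbol. -/
structure ForbGrammar (S T : Type) where
  start : S
  Idx : Type
  lhs : Idx → S
  forb : Idx → Finset S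
  rhs : Idx → List (Symb S T)

namespace ForbGrammar

variable {S : Type} (F : ForbGrammar S T)

/-- A derivation step in which no nonterminal occurs twice. -/
def Step (u v : List (Symb S T)) : Prop :=
  ∃ i x y, u = x ++ Symb.nt (F.lhs i) :: y ∧ v = x ++ F.rhs i ++ y ∧
    (∀ s ∈ F.forb i, s ∉ ntList (x ++ y)) ∧ (ntList u).Nodup ∧ (ntList v).Nodup

def Lang : Set (List T) :=
  { w | Relation.ReflTransGen F.Step [Symb.nt F.start] (w.map Symb.tm) }

/-- The word that tests the forbidding condition of the rule `i`: a lock symbol, a symbol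
recording the rule, and all forbidden symbols. -/
noncomputable def guard (i : F.Idx) : List (S ⊕ Option F.Idx) :=
  Sum.inr none :: Sum.inr (some i) :: (F.forb i).toList.map Sum.inl

noncomputable def openRule (i : F.Idx) :
    ((S ⊕ Option F.Idx) × List (S ⊕ Option F.Idx)) × List (Symb (S ⊕ Option F.Idx) T) :=
  ((Sum.inl (F.lhs i), []), (F.guard i).map Symb.nt)

noncomputable def closeRule (i : F.Idx) :
    ((S ⊕ Option F.Idx) × List (S ⊕ Option F.Idx)) × List (Symb (S ⊕ Option F.Idx) T) :=
  ((Sum.inr none, Sum.inr (some i) :: (F.forb i).toList.map Sum.inl),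
    (F.rhs i).map (mapSymb Sum.inl))

/-- The Ginsburg–Spanier grammar simulating a grammar with forbidding contexts. -/
noncomputable def toGSG [Finite F.Idx] : GSG (S ⊕ Option F.Idx) T where
  start := Sum.inl F.start
  rules := ((Set.finite_range F.openRule).union (Set.finite_range F.closeRule)).toFinset

theorem nodup_ntList_guard {x y : List (Symb S T)} (i : F.Idx) :
    (ntList (x.map (mapSymb Sum.inl) ++ (F.guard i).map Symb.nt ++
      y.map (mapSymb Sum.inl))).Nodup ↔
    (ntList (x ++ y)).Nodup ∧ ∀ s ∈ F.forb i, s ∉ ntList (x ++ y) := by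
  have hp : (ntList (x.map (mapSymb Sum.inl) ++ (F.guard i).map Symb.nt ++
      y.map (mapSymb Sum.inl))).Perm
      ((Sum.inr none :: [Sum.inr (some i)]) ++
        ((F.forb i).toList ++ ntList (x ++ y)).map Sum.inl) := by
    simp only [ntList_append, ntList_map_mapSymb, ntList_map_nt, guard, List.map_append]
    rw [List.append_assoc]
    refine List.perm_append_comm.trans ?_
    simp only [List.cons_append, List.append_assoc, List.nil_append]
    refine ((List.Perm.append_left _ List.perm_append_comm).cons _).cons _
  rw [hp.nodup_iff]
  simp only [List.cons_append, List.nil_append, List.nodup_cons,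
    List.nodup_map_iff Sum.inl_injective, List.nodup_append', List.Disjoint]
  simp [Finset.nodup_toList]

theorem nodup_ntList_inl {u : List (Symb S T)} :
    (ntList (u.map (mapSymb (Sum.inl : S → S ⊕ Option F.Idx)))).Nodup ↔ (ntList u).Nodup := by
  rw [ntList_map_mapSymb, List.nodup_map_iff Sum.inl_injective]

theorem reflTransGen_capStep_of_step [Finite F.Idx] {u v : List (Symb S T)} (h : F.Step u v) :
    Relation.ReflTransGen (F.toGSG.CapStep fun _ => 1)
      (u.map (mapSymb Sum.inl)) (v.map (mapSymb Sum.inl)) := by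
  obtain ⟨i, x, y, rfl, rfl, hf, hu, hv⟩ := h
  have hxy : (ntList (x ++ y)).Nodup := by
    refine hu.sublist ?_
    simp
  have hm := (F.nodup_ntList_guard i).mpr ⟨hxy, hf⟩
  have hopen : F.toGSG.CapStep (fun _ => 1) ((x ++ Symb.nt (F.lhs i) :: y).map (mapSymb Sum.inl))
      (x.map (mapSymb Sum.inl) ++ (F.guard i).map Symb.nt ++ y.map (mapSymb Sum.inl)) :=
    ⟨⟨F.openRule i, by simp [toGSG], x.map (mapSymb Sum.inl), y.map (mapSymb Sum.inl),
      by simp [openRule, mapSymb], rfl⟩, capOK_one_iff.mpr (F.nodup_ntList_inl.mpr hu),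
      capOK_one_iff.mpr hm⟩
  have hclose : F.toGSG.CapStep (fun _ => 1)
      (x.map (mapSymb Sum.inl) ++ (F.guard i).map Symb.nt ++ y.map (mapSymb Sum.inl))
      ((x ++ F.rhs i ++ y).map (mapSymb Sum.inl)) :=
    ⟨⟨F.closeRule i, by simp [toGSG], x.map (mapSymb Sum.inl), y.map (mapSymb Sum.inl), rfl,
      by simp [closeRule]⟩, capOK_one_iff.mpr hm, capOK_one_iff.mpr (F.nodup_ntList_inl.mpr hv)⟩
  exact (Relation.ReflTransGen.single hopen).tail hclose

/-- Sentential forms of the simulating grammar: either encoded sentential forms, or such forms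
with one rewritten nonterminal replaced by the guard of the rule. -/
def Simulates (f : List (Symb (S ⊕ Option F.Idx) T)) : Prop :=
  (∃ u, f = u.map (mapSymb Sum.inl) ∧
    Relation.ReflTransGen F.Step [Symb.nt F.start] u) ∨
  ∃ i x y, f = x.map (mapSymb Sum.inl) ++ (F.guard i).map Symb.nt ++ y.map (mapSymb Sum.inl) ∧
    Relation.ReflTransGen F.Step [Symb.nt F.start] (x ++ Symb.nt (F.lhs i) :: y) ∧
    (ntList (x ++ Symb.nt (F.lhs i) :: y)).Nodup

theorem not_inr_mem {u : List (Symb S T)} {o : Option F.Idx} :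
    Symb.nt (Sum.inr o) ∉ u.map (mapSymb (Sum.inl : S → S ⊕ Option F.Idx)) := by
  rw [← mem_ntList]
  simp

theorem Simulates.capStep [Finite F.Idx] {f g : List (Symb (S ⊕ Option F.Idx) T)}
    (hf : F.Simulates f) (h : F.toGSG.CapStep (fun _ => 1) f g) : F.Simulates g := by
  obtain ⟨⟨r, hr, X, Y, hX, rfl⟩, hcf, hcg⟩ := h
  rw [capOK_one_iff] at hcf hcg
  have hr' : (∃ i, F.openRule i = r) ∨ ∃ i, F.closeRule i = r := by
    simpa [toGSG] using hr
  rcases hf with ⟨u, rfl, hu⟩ | ⟨i, x, y, rfl, hu, hn⟩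
  · rcases hr' with ⟨j, rfl⟩ | ⟨j, rfl⟩
    · simp only [openRule, List.map_cons, List.map_nil, List.append_assoc, List.cons_append,
        List.nil_append] at hX
      obtain ⟨x, a, y, rfl, rfl, ha, rfl⟩ := map_mapSymb_eq_split hX
      cases Sum.inl_injective ha
      exact Or.inr ⟨j, x, y, rfl, hu, F.nodup_ntList_inl.mp hcf⟩
    · refine absurd ?_ (F.not_inr_mem (u := u) (o := none))
      rw [hX]
      simp [closeRule]
  · rcases hr' with ⟨j, rfl⟩ | ⟨j, rfl⟩
    · exfalso
      have hlock : Symb.nt (Sum.inr none) ∈ X ++ Y := by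
        have : Symb.nt (Sum.inr none) ∈ X ++ ((F.openRule j).1.1 :: (F.openRule j).1.2).map
            Symb.nt ++ Y := by
          rw [← hX]
          simp [guard]
        simpa [openRule] using this
      simp only [openRule, guard, List.map_cons, ntList_append, ntList_nt, List.append_assoc,
        List.cons_append] at hcg
      rw [← mem_ntList, ntList_append] at hlock
      have := List.nodup_middle.mp hcg
      simp at this hlock
      tauto
    · have hlx := F.not_inr_mem (u := x) (o := none)
      have hly := F.not_inr_mem (u := y) (o := none)
      simp only [guard, closeRule, List.map_cons, List.append_assoc, List.cons_append] at hX
      obtain ⟨rfl, -, h2⟩ := (List.append_cons_inj_of_notMem hlx (by simp [hly])).mp hX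
      simp only [List.cons.injEq, Symb.nt.injEq, Sum.inr.injEq, Option.some.injEq] at h2
      obtain ⟨rfl, h2⟩ := h2
      obtain rfl := List.append_cancel_left h2
      have hnm := hcf
      rw [F.nodup_ntList_guard] at hnm
      have hv : x.map (mapSymb Sum.inl) ++ (F.closeRule i).2 ++ y.map (mapSymb Sum.inl) =
          (x ++ F.rhs i ++ y).map (mapSymb Sum.inl) := by
        simp [closeRule]
      rw [hv] at hcg ⊢
      exact Or.inl ⟨_, rfl, hu.tail ⟨i, x, y, rfl, rfl, hnm.2, hn, F.nodup_ntList_inl.mp hcg⟩⟩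

theorem capLang_toGSG [Finite F.Idx] : F.toGSG.CapLang (fun _ => 1) = F.Lang := by
  ext w
  constructor
  · intro h
    have key : ∀ f, Relation.ReflTransGen (F.toGSG.CapStep fun _ => 1)
        [Symb.nt F.toGSG.start] f → F.Simulates f := by
      intro f hf
      induction hf with
      | refl => exact Or.inl ⟨[Symb.nt F.start], rfl, .refl⟩
      | tail _ h ih => exact ih.capStep F h
    rcases key _ h with ⟨u, hu, hr⟩ | ⟨i, x, y, hu, -⟩
    · rwa [eq_map_tm_of_map_mapSymb hu.symm] at hr
    · have := congrArg ntList hu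
      simp [guard] at this
  · intro h
    have key : ∀ u, Relation.ReflTransGen F.Step [Symb.nt F.start] u →
        Relation.ReflTransGen (F.toGSG.CapStep fun _ => 1)
          [Symb.nt F.toGSG.start] (u.map (mapSymb Sum.inl)) := by
      intro u hu
      induction hu with
      | refl => exact .refl
      | tail _ h ih => exact ih.trans (F.reflTransGen_capStep_of_step h)
    have := key _ h
    rwa [map_mapSymb_map_tm] at this

end ForbGrammar

/-! Simulation of matrix grammars of finite index by grammars with forbidding contexts. -/

theorem DerivP.snoc {P : List (Symb N T) → Prop} {π : List (N × List (Symb N T))}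
    {r : N × List (Symb N T)} {u v w : List (Symb N T)} (h : DerivP P π u v)
    (hr : applyRule r v w) (hw : P w) : DerivP P (π ++ [r]) u w := by
  induction h with
  | nil u hu => exact .cons hu hr (.nil _ hw)
  | cons hu hs _ ih => exact .cons hu hs (ih hr)

theorem DerivP.head {P : List (Symb N T) → Prop} {π : List (N × List (Symb N T))}
    {u v : List (Symb N T)} (h : DerivP P π u v) : P u := by
  cases h <;> assumption

/-- Forget the slots of the nonterminals. -/
abbrev uncolor {C : Type} (u : List (Symb (C × N) T)) : List (Symb N T) :=
  u.map (mapSymb Prod.snd)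

/-- A form with few nonterminals can be colored injectively, avoiding the given colors. -/
theorem exists_coloring {C : Type} [Fintype C] (u : List (Symb N T)) (l : List (C × N))
    (h : l.length + ntCount u ≤ Fintype.card C) :
    ∃ v : List (Symb (C × N) T), uncolor v = u ∧ (ntList v).Nodup ∧ ∀ a ∈ ntList v, a ∉ l := by
  classical
  induction u generalizing l with
  | nil => exact ⟨[], rfl, by simp, by simp⟩
  | cons s u ih =>
    cases s with
    | tm a =>
      obtain ⟨v, rfl, hv⟩ := ih l h
      exact ⟨Symb.tm a :: v, rfl, hv⟩
    | nt A =>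
      simp only [ntCount] at h
      obtain ⟨i, hi⟩ : ∃ i, i ∉ (l.map Prod.fst).toFinset := by
        by_contra! hall
        have h1 := Finset.card_le_card (fun i _ => hall i : Finset.univ ⊆ _)
        have h2 := (l.map Prod.fst).toFinset_card_le
        rw [Finset.card_univ] at h1
        simp at h2
        omega
      obtain ⟨v, rfl, hv, hl⟩ := ih ((i, A) :: l) (by simp; omega)
      refine ⟨Symb.nt (i, A) :: v, rfl, ?_, ?_⟩
      · exact List.nodup_cons.mpr ⟨fun hm => hl _ hm (by simp), hv⟩
      · intro a ha
        rcases List.mem_cons.mp ha with rfl | ha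
        · intro hm
          exact hi (by simpa using ⟨A, hm⟩)
        · exact fun hm => hl a ha (List.mem_cons_of_mem _ hm)

/-- Nonterminals tagged with a slot. -/
abbrev Slot (N : Type) (n : ℕ) : Type := Fin (n + 2) × N

/-- An order to replace a tagged nonterminal by a tagged word, with the rules of the current
matrix that are to be applied afterwards. -/
abbrev Order (N T : Type) (n : ℕ) : Type :=
  Slot N n × List (Symb (Slot N n) T) × List (N × List (Symb N T))

/-- The rules of the current matrix that are still to be applied when the order is issued. -/
def Order.ruleSeq {n : ℕ} (o : Order N T n) : List (N × List (Symb N T)) :=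
  (o.1.2, uncolor o.2.1) :: o.2.2

/-- The order that is considered as executed at the beginning. -/
def initOrder (G : MG N T) (n : ℕ) : Order N T n :=
  ((1, G.start), [Symb.nt (0, G.start)], [])

/-- The orders that occur in derivations. -/
def orders (G : MG N T) (n : ℕ) : Set (Order N T n) :=
  insert (initOrder G n) {o | ∃ m ∈ G.mats, o.ruleSeq <:+ m}

theorem finite_orders [Finite N] (G : MG N T) (n : ℕ) : (orders G n).Finite := by
  refine Set.Finite.insert _ ?_
  have hs : (⋃ m ∈ G.mats, {l | l ∈ m.tails}).Finite :=
    G.mats.finite_toSet.biUnion fun m _ => m.tails.finite_toSet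
  refine (hs.preimage' (f := Order.ruleSeq) ?_).subset ?_
  · rintro (_ | ⟨r, ρ⟩) -
    · exact Set.finite_empty.subset (by rintro o ⟨⟩)
    · refine ((Set.finite_univ (α := Slot N n)).prod
        ((finite_map_mapSymb_fiber Prod.snd r.2).prod (Set.finite_singleton ρ))).subset ?_
      rintro ⟨a, v, σ⟩ h
      simp only [Order.ruleSeq, Set.mem_preimage, Set.mem_singleton_iff, List.cons.injEq] at h
      obtain ⟨rfl, rfl⟩ := h
      exact ⟨trivial, rfl, rfl⟩
  · rintro o ⟨m, hm, h⟩
    simpa using ⟨m, hm, h⟩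

/-- A state of the control symbol: the tagged nonterminals outside the ordered one, and the
current order. -/
abbrev Ctl (G : MG N T) (n : ℕ) : Type :=
  {c : Finset (Slot N n) × Order N T n // c.2 ∈ orders G n}

namespace Ctl

variable {G : MG N T} {n : ℕ}

abbrev base (c : Ctl G n) : Finset (Slot N n) := c.1.1
abbrev target (c : Ctl G n) : Slot N n := c.1.2.1
abbrev result (c : Ctl G n) : List (Symb (Slot N n) T) := c.1.2.2.1
abbrev pending (c : Ctl G n) : List (N × List (Symb N T)) := c.1.2.2.2
abbrev ruleSeq (c : Ctl G n) : List (N × List (Symb N T)) := c.1.2.ruleSeq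

/-- The ordered nonterminal disappears when the order is executed. -/
def Fresh (c : Ctl G n) : Prop := c.target ∉ c.base ∧ c.target ∉ ntList c.result

/-- The set of tagged nonterminals before the execution of the order. -/
def Waiting (c : Ctl G n) (w : List (Symb (Slot N n) T)) : Prop :=
  ∀ s, s ∈ ntList w ↔ s = c.target ∨ s ∈ c.base

/-- The set of tagged nonterminals after the execution of the order. -/
def Done (c : Ctl G n) (w : List (Symb (Slot N n) T)) : Prop :=
  ∀ s, s ∈ ntList w ↔ s ∈ c.base ∨ s ∈ ntList c.result

/-- The order of `c'` may be issued after the execution of the order of `c`. -/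
def Next (c c' : Ctl G n) : Prop :=
  c'.Fresh ∧ (∀ s, (s ∈ c.base ∨ s ∈ ntList c.result) ↔ (s = c'.target ∨ s ∈ c'.base)) ∧
    (c.pending = c'.ruleSeq ∨ c.pending = [] ∧ c'.ruleSeq ∈ G.mats)

/-- The state at the beginning of a derivation. -/
def initial (G : MG N T) (n : ℕ) : Ctl G n := ⟨(∅, initOrder G n), Set.mem_insert _ _⟩

theorem fresh_initial : (initial G n).Fresh := by
  simp [Fresh, initial, initOrder, target, base, result]

end Ctl

/-- The symbols of the simulating grammar: start symbol, control symbols, tagged nonterminals. -/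
abbrev SimSym (G : MG N T) (n : ℕ) : Type := Option (Ctl G n ⊕ Slot N n)

instance finite_ctl [Finite N] (G : MG N T) (n : ℕ) : Finite (Ctl G n) := by
  have := ((Set.finite_univ (α := Finset (Slot N n))).prod (finite_orders G n)).to_subtype
  exact Finite.of_injective (fun c : Ctl G n =>
    (⟨c.1, trivial, c.2⟩ : (Set.univ ×ˢ orders G n : Set _))) fun c d h => by
      simpa [Subtype.ext_iff] using h

/-- The rules: starting, executing an order, issuing the next order, and terminating. -/
abbrev SimIdx (G : MG N T) (n : ℕ) : Type :=
  Unit ⊕ Ctl G n ⊕ {p : Ctl G n × Ctl G n // p.1.Next p.2} ⊕ {c : Ctl G n // c.pending = []}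

/-- The grammar with forbidding contexts that simulates a matrix grammar. -/
noncomputable def simGrammar [Finite N] (G : MG N T) (n : ℕ) : ForbGrammar (SimSym G n) T where
  start := none
  Idx := SimIdx G n
  lhs
    | .inl _ => none
    | .inr (.inl c) => some (.inr c.target)
    | .inr (.inr (.inl p)) => some (.inl p.1.1)
    | .inr (.inr (.inr c)) => some (.inl c.1)
  forb
    | .inl _ => ∅
    | .inr (.inl c) => (Set.toFinite {s | ∃ d, d ≠ c ∧ s = some (.inl d)}).toFinset
    | .inr (.inr (.inl p)) => {some (.inr p.1.1.target)}
    | .inr (.inr (.inr _)) => (Set.toFinite (Set.range fun a => some (.inr a))).toFinset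
  rhs
    | .inl _ => [Symb.nt (some (.inl (Ctl.initial G n))), Symb.nt (some (.inr (0, G.start)))]
    | .inr (.inl c) => c.result.map (mapSymb fun a => some (.inr a))
    | .inr (.inr (.inl p)) => [Symb.nt (some (.inl p.1.2))]
    | .inr (.inr (.inr _)) => []

section Simulation

variable {G : MG N T} {n : ℕ}

/-- The sentential form consisting of a control symbol and a tagged form. -/
def simForm (c : Ctl G n) (w : List (Symb (Slot N n) T)) : List (Symb (SimSym G n) T) :=
  Symb.nt (some (.inl c)) :: w.map (mapSymb fun a => some (.inr a))

theorem ntList_simForm (c : Ctl G n) (w : List (Symb (Slot N n) T)) :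
    ntList (simForm c w) = some (.inl c) :: (ntList w).map fun a => some (.inr a) := by
  simp [simForm]

theorem nodup_simForm {c : Ctl G n} {w : List (Symb (Slot N n) T)} :
    (ntList (simForm c w)).Nodup ↔ (ntList w).Nodup := by
  rw [ntList_simForm, List.nodup_cons, List.nodup_map_iff (fun a b h => by simpa using h)]
  simp

theorem simForm_split_slot {c : Ctl G n} {w : List (Symb (Slot N n) T)} {a : Slot N n}
    {x y : List (Symb (SimSym G n) T)} (h : simForm c w = x ++ Symb.nt (some (.inr a)) :: y) :
    ∃ w₁ w₂, w = w₁ ++ Symb.nt a :: w₂ ∧ x = simForm c w₁ ∧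
      y = w₂.map (mapSymb fun a => some (.inr a)) := by
  cases x with
  | nil => simp [simForm] at h
  | cons s x =>
    simp only [simForm, List.cons_append, List.cons.injEq] at h
    obtain ⟨rfl, h⟩ := h
    obtain ⟨w₁, b, w₂, rfl, rfl, hb, rfl⟩ := map_mapSymb_eq_split h
    obtain rfl : b = a := by simpa using hb
    exact ⟨w₁, w₂, rfl, rfl, rfl⟩

theorem simForm_split_ctl {c d : Ctl G n} {w : List (Symb (Slot N n) T)}
    {x y : List (Symb (SimSym G n) T)} (h : simForm c w = x ++ Symb.nt (some (.inl d)) :: y) :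
    x = [] ∧ d = c ∧ y = w.map (mapSymb fun a => some (.inr a)) := by
  cases x with
  | nil =>
    simp only [simForm, List.nil_append, List.cons.injEq, Symb.nt.injEq, Option.some.injEq,
      Sum.inl.injEq] at h
    exact ⟨rfl, h.1.symm, h.2.symm⟩
  | cons s x =>
    simp only [simForm, List.cons_append, List.cons.injEq] at h
    obtain ⟨w₁, b, w₂, -, -, hb, -⟩ := map_mapSymb_eq_split h.2
    simp at hb

theorem none_notMem_simForm {c : Ctl G n} {w : List (Symb (Slot N n) T)} :
    none ∉ ntList (simForm c w) := by
  simp [ntList_simForm]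

/-- The sentential forms of the simulating grammar, with the corresponding matrix derivations. -/
inductive Reach (G : MG N T) (n : ℕ) : List (Symb (SimSym G n) T) → Prop
  | start : Reach G n [Symb.nt none]
  | waiting {c : Ctl G n} {w : List (Symb (Slot N n) T)} {π : List (N × List (Symb N T))}
      {ms : List (List (N × List (Symb N T)))} : c.Fresh → c.Waiting w → (∀ m ∈ ms, m ∈ G.mats) →
      DerivP (fun _ => True) π [Symb.nt G.start] (uncolor w) → ms.flatten = π ++ c.ruleSeq →
      Reach G n (simForm c w)
  | done {c : Ctl G n} {w : List (Symb (Slot N n) T)} {π : List (N × List (Symb N T))}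
      {ms : List (List (N × List (Symb N T)))} : c.Fresh → c.Done w → (∀ m ∈ ms, m ∈ G.mats) →
      DerivP (fun _ => True) π [Symb.nt G.start] (uncolor w) → ms.flatten = π ++ c.pending →
      Reach G n (simForm c w)
  | word {w} : w ∈ G.Lang → Reach G n (w.map Symb.tm)

/-- Executing the order turns a waiting form into a done one. -/
theorem Ctl.Waiting.done {c : Ctl G n} {x y : List (Symb (Slot N n) T)} (hc : c.Fresh)
    (hw : c.Waiting (x ++ Symb.nt c.target :: y))
    (hn : (ntList (x ++ Symb.nt c.target :: y)).Nodup) : c.Done (x ++ c.result ++ y) := by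
  intro s
  have h := hw s
  rw [ntList_append, ntList_nt, List.nodup_middle, List.nodup_cons] at hn
  simp only [ntList_append, ntList_nt, List.mem_append, List.mem_cons] at h hn ⊢
  have hb := hc.1
  by_cases hs : s = c.target
  · subst hs
    tauto
  · tauto

theorem Reach.step [Finite N] {f g : List (Symb (SimSym G n) T)} (hf : Reach G n f)
    (h : (simGrammar G n).Step f g) : Reach G n g := by
  obtain ⟨i, x, y, hx, rfl, hforb, hnf, hng⟩ := h
  have hmem : (simGrammar G n).lhs i ∈ ntList f := by simp [hx]
  cases hf with
  | word hw => simp at hmem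
  | start =>
    obtain ⟨rfl, rfl⟩ : x = [] ∧ y = [] := by
      have := congrArg List.length hx
      simp at this
      exact ⟨List.length_eq_zero_iff.mp (by omega), List.length_eq_zero_iff.mp (by omega)⟩
    rcases i with _ | c | p | c
    · refine Reach.done (c := Ctl.initial G n) (w := [Symb.nt (0, G.start)]) (π := []) (ms := [])
        Ctl.fresh_initial ?_ (by simp) (.nil _ trivial) rfl
      simp [Ctl.Done, Ctl.initial, initOrder, Ctl.base, Ctl.result]
    all_goals simp [simGrammar] at hmem
  | @waiting c w π ms hc hw hms hd hfl =>
    rcases i with _ | d | ⟨⟨d, d'⟩, hp⟩ | d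
    · exact absurd hmem none_notMem_simForm
    · obtain ⟨w₁, w₂, rfl, rfl, rfl⟩ := simForm_split_slot hx
      obtain rfl : c = d := by
        by_contra hne
        exact hforb (some (.inl c)) ((Set.Finite.mem_toFinset _).mpr ⟨c, hne, rfl⟩)
          (by simp [ntList_simForm])
      have hg : simForm c w₁ ++ (simGrammar G n).rhs (.inr (.inl c)) ++
          w₂.map (mapSymb fun a => some (.inr a)) = simForm c (w₁ ++ c.result ++ w₂) := by
        simp [simForm, simGrammar]
      rw [hg]
      refine Reach.done hc (hw.done hc (nodup_simForm.mp hnf)) hms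
        (hd.snoc (r := (c.target.2, uncolor c.result)) ?_ trivial) (by rw [hfl, List.append_assoc]; rfl)
      exact ⟨uncolor w₁, uncolor w₂, by simp [mapSymb], by simp⟩
    · obtain ⟨rfl, rfl, rfl⟩ := simForm_split_ctl hx
      refine absurd ?_ (hforb (some (.inr d.target)) (by simp [simGrammar]))
      have := (hw d.target).mpr (Or.inl rfl)
      simpa using this
    · obtain ⟨rfl, hdc, rfl⟩ := simForm_split_ctl hx
      refine absurd ?_ (hforb (some (.inr c.target)) (by simp [simGrammar]))
      have := (hw c.target).mpr (Or.inl rfl)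
      simpa using this
  | @done c w π ms hc hw hms hd hfl =>
    rcases i with _ | d | ⟨⟨d, d'⟩, hp⟩ | d
    · exact absurd hmem none_notMem_simForm
    · obtain ⟨w₁, w₂, rfl, rfl, rfl⟩ := simForm_split_slot hx
      obtain rfl : c = d := by
        by_contra hne
        exact hforb (some (.inl c)) ((Set.Finite.mem_toFinset _).mpr ⟨c, hne, rfl⟩)
          (by simp [ntList_simForm])
      have := (hw c.target).mp (by simp)
      exact absurd this (not_or.mpr hc)
    · obtain ⟨rfl, rfl, rfl⟩ := simForm_split_ctl hx
      obtain ⟨hf', hset, hseq⟩ := hp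
      have hw' : d'.Waiting w := fun s => (hw s).trans (hset s)
      rcases hseq with hseq | ⟨hnil, hm⟩
      · exact Reach.waiting hf' hw' hms hd (hfl.trans (congrArg (π ++ ·) hseq))
      · refine Reach.waiting (ms := ms ++ [d'.ruleSeq]) hf' hw' ?_ hd ?_
        · intro m hm'
          rcases List.mem_append.mp hm' with h | h
          · exact hms m h
          · rwa [List.mem_singleton.mp h]
        · have hnil' : d.pending = [] := hnil
          simp [hfl, hnil']
    · obtain ⟨rfl, hdc, rfl⟩ := simForm_split_ctl hx
      have hnil : ntList w = [] := by
        refine List.eq_nil_iff_forall_not_mem.mpr fun a ha => ?_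
        exact hforb (some (.inr a)) (by simp [simGrammar]) (by simpa using ha)
      obtain ⟨v, rfl⟩ := exists_map_tm_of_ntList_eq_nil hnil
      have hg : [] ++ (simGrammar G n).rhs (.inr (.inr (.inr d))) ++
          (v.map Symb.tm).map (mapSymb fun a : Slot N n => (some (.inr a) : SimSym G n)) =
          v.map Symb.tm := by
        rw [map_mapSymb_map_tm]
        rfl
      rw [hg]
      refine Reach.word ⟨ms, hms, ?_⟩
      have hd2 := d.2
      simp only [hdc] at hd2
      rw [hfl, hd2, List.append_nil]
      rwa [uncolor, map_mapSymb_map_tm] at hd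

theorem simGrammar_lang_subset [Finite N] : (simGrammar G n).Lang ⊆ G.Lang := by
  intro w h
  have key : ∀ f, Relation.ReflTransGen (simGrammar G n).Step [Symb.nt none] f → Reach G n f := by
    intro f hf
    induction hf with
    | refl => exact .start
    | tail _ h ih => exact ih.step h
  have hw := key _ h
  generalize hf : w.map Symb.tm = f at hw
  cases hw with
  | word hv => rwa [List.map_injective_iff.mpr (fun _ _ h => Symb.tm.inj h) hf]
  | start => simpa using congrArg ntList hf
  | waiting => simpa [ntList_simForm] using congrArg ntList hf
  | done => simpa [ntList_simForm] using congrArg ntList hf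

/-- The first rule of a concatenation of matrices is the first rule of some matrix. -/
theorem exists_matrix_of_flatten_eq_cons {β : Type} {M : Finset (List β)} {ms : List (List β)}
    {r : β} {π : List β} (hms : ∀ m ∈ ms, m ∈ M) (h : ms.flatten = r :: π) :
    ∃ (ρ : List β) (ms' : List (List β)), r :: ρ ∈ M ∧ (∀ m ∈ ms', m ∈ M) ∧ π = ρ ++ ms'.flatten := by
  induction ms with
  | nil => simp at h
  | cons m ms ih =>
    cases m with
    | nil => exact ih (fun m hm => hms m (by simp [hm])) (by simpa using h)
    | cons b ρ =>
      simp only [List.flatten_cons, List.cons_append, List.cons.injEq] at h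
      obtain ⟨rfl, rfl⟩ := h
      exact ⟨ρ, ms, hms _ (by simp), fun m hm => hms m (by simp [hm]), rfl⟩

theorem simGrammar_derives [Finite N] {k : ℕ} {π : List (N × List (Symb N T))}
    {u v : List (Symb N T)} {z : List T} (hd : DerivP (fun u => ntCount u ≤ k) π u v)
    (hv : v = z.map Symb.tm) (c : Ctl G (2 * k)) (w : List (Symb (Slot N (2 * k)) T))
    (hu : uncolor w = u) (hn : (ntList w).Nodup) (hc : c.Fresh) (hw : c.Done w)
    (ms : List (List (N × List (Symb N T)))) (hms : ∀ m ∈ ms, m ∈ G.mats)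
    (hπ : π = c.pending ++ ms.flatten) :
    Relation.ReflTransGen (simGrammar G (2 * k)).Step (simForm c w) (z.map Symb.tm) := by
  classical
  induction hd generalizing c w ms with
  | nil u _ =>
    obtain rfl := eq_map_tm_of_map_mapSymb (hu.trans hv)
    have hp : c.pending = [] := (List.append_eq_nil_iff.mp hπ.symm).1
    refine .single ⟨.inr (.inr (.inr ⟨c, hp⟩)), [], _, rfl, ?_, ?_, ?_, ?_⟩
    · rw [map_mapSymb_map_tm]
      rfl
    · rw [map_mapSymb_map_tm]
      simp
    · exact nodup_simForm.mpr hn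
    · simp
  | @cons r π u u' _ huk hr hd ih =>
    obtain ⟨x, y, rfl, rfl⟩ := hr
    obtain ⟨w₁, a, w₂, rfl, rfl, ha, rfl⟩ := map_mapSymb_eq_split hu
    have hrk : ntCount r.2 ≤ k := by
      have := hd.head
      simp only [ntCount_eq_length, ntList_append, List.length_append] at this ⊢
      omega
    obtain ⟨α, hα, hαn, hαw⟩ := exists_coloring r.2 (ntList (w₁ ++ Symb.nt a :: w₂)) (by
      simp only [Fintype.card_fin]
      rw [← hu] at huk
      simp only [ntCount_eq_length, uncolor, ntList_map_mapSymb, List.length_map] at huk hrk ⊢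
      omega)
    have hrα : (a.2, uncolor α) = r := Prod.ext ha hα
    obtain ⟨ρ, ms', hρ, hms', hπ'⟩ : ∃ (ρ : List (N × List (Symb N T)))
        (ms' : List (List (N × List (Symb N T)))), (c.pending = r :: ρ ∨
        c.pending = [] ∧ r :: ρ ∈ G.mats) ∧ (∀ m ∈ ms', m ∈ G.mats) ∧ π = ρ ++ ms'.flatten := by
      rcases hp : c.pending with _ | ⟨r', ρ⟩
      · rw [hp] at hπ
        obtain ⟨ρ, ms', h1, h2, h3⟩ := exists_matrix_of_flatten_eq_cons hms hπ.symm
        exact ⟨ρ, ms', Or.inr ⟨rfl, h1⟩, h2, h3⟩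
      · rw [hp] at hπ
        simp only [List.cons_append, List.cons.injEq] at hπ
        obtain ⟨rfl, hπ⟩ := hπ
        exact ⟨ρ, ms, Or.inl rfl, hms, hπ⟩
    have hmem : ((a, α, ρ) : Order N T (2 * k)) ∈ orders G (2 * k) := by
      refine Or.inr ?_
      simp only [Order.ruleSeq, hrα, Set.mem_ofPred_eq]
      rcases hρ with hρ | ⟨-, hρ⟩
      · rcases c.2 with hi | ⟨m, hm, hs⟩
        · simp [Ctl.pending, hi, initOrder] at hρ
        · exact ⟨m, hm, hρ ▸ (List.suffix_cons _ _).trans hs⟩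
      · exact ⟨_, hρ, List.suffix_rfl⟩
    have hn' := hn
    rw [ntList_append, ntList_nt, List.nodup_middle, List.nodup_cons] at hn'
    let c' : Ctl G (2 * k) := ⟨((ntList w₁ ++ ntList w₂).toFinset, a, α, ρ), hmem⟩
    have hc' : c'.Fresh :=
      ⟨fun h => hn'.1 (List.mem_toFinset.mp h), fun h => hαw _ h (by simp [c'])⟩
    have hw' : c'.Waiting (w₁ ++ Symb.nt a :: w₂) := by
      intro s
      simp [c', Ctl.base, Ctl.target]
      tauto
    have hnext : c.Next c' := by
      refine ⟨hc', fun s => (hw s).symm.trans (hw' s), ?_⟩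
      simpa only [c', Ctl.ruleSeq, Order.ruleSeq, hrα] using hρ
    have hnα : (ntList (w₁ ++ α ++ w₂)).Nodup := by
      have : (ntList (w₁ ++ α ++ w₂)).Perm (ntList α ++ (ntList w₁ ++ ntList w₂)) := by
        simp only [ntList_append]
        rw [← List.append_assoc]
        exact List.perm_append_comm.append_right _
      rw [this.nodup_iff, List.nodup_append']
      refine ⟨hαn, hn'.2, fun s hs hs' => hαw s hs ?_⟩
      simp only [ntList_append, ntList_nt, List.mem_append, List.mem_cons] at hs' ⊢
      tauto
    have hstep₁ : (simGrammar G (2 * k)).Step (simForm c (w₁ ++ Symb.nt a :: w₂))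
        (simForm c' (w₁ ++ Symb.nt a :: w₂)) := by
      refine ⟨.inr (.inr (.inl ⟨(c, c'), hnext⟩)), [], _, rfl, rfl, ?_, nodup_simForm.mpr hn,
        nodup_simForm.mpr hn⟩
      intro s hs
      obtain rfl : s = some (.inr c.target) := by simpa [simGrammar] using hs
      have : c.target ∉ ntList (w₁ ++ Symb.nt a :: w₂) := fun h => not_or.mpr hc ((hw _).mp h)
      rw [List.nil_append, ntList_map_mapSymb]
      intro h
      obtain ⟨b, hb, hbc⟩ := List.mem_map.mp h
      obtain rfl : b = c.target := by simpa using hbc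
      exact this hb
    have hstep₂ : (simGrammar G (2 * k)).Step (simForm c' (w₁ ++ Symb.nt a :: w₂))
        (simForm c' (w₁ ++ α ++ w₂)) := by
      refine ⟨.inr (.inl c'), simForm c' w₁, w₂.map (mapSymb fun a => some (.inr a)), ?_, ?_, ?_,
        nodup_simForm.mpr hn, nodup_simForm.mpr hnα⟩
      · simp [simForm, simGrammar, mapSymb, c']
      · simp [simForm, simGrammar, c']
      · intro s hs
        obtain ⟨d, hd, rfl⟩ : ∃ d, d ≠ c' ∧ s = some (.inl d) := by simpa [simGrammar] using hs
        simpa [ntList_simForm] using hd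
    refine .head hstep₁ (.head hstep₂ (ih hv c' _ ?_ hnα hc' (hw'.done hc' hn) ms' hms' hπ'))
    simp [hα]

theorem finLang_subset_simGrammar_lang [Finite N] {k : ℕ} :
    G.FinLang k ⊆ (simGrammar G (2 * k)).Lang := by
  rintro z ⟨ms, hms, hd⟩
  refine .head (b := simForm (Ctl.initial G (2 * k)) [Symb.nt (0, G.start)])
    ⟨.inl (), [], [], rfl, rfl, ?_, ?_, nodup_simForm.mpr ?_⟩
    (simGrammar_derives hd rfl _ _ rfl ?_ Ctl.fresh_initial ?_ ms hms rfl)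
  · simp
  · simp
  · simp
  · simp
  · simp [Ctl.Done, Ctl.initial, initOrder, Ctl.base, Ctl.result]

end Simulation


/-- MAT_fin ⊆ GS_cb. -/
theorem MATfin_subset_GScb (T : Type) : MATfin T ⊆ GScb T := by
  rintro L ⟨N, _, G, k, rfl, hk⟩
  have : Finite (simGrammar G (2 * k)).Idx := inferInstanceAs (Finite (SimIdx G (2 * k)))
  refine ⟨SimSym G (2 * k) ⊕ Option (simGrammar G (2 * k)).Idx, Fintype.ofFinite _,
    (simGrammar G (2 * k)).toGSG, fun _ => 1, ?_⟩
  rw [ForbGrammar.capLang_toGSG]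
  exact (hk.trans finLang_subset_simGrammar_lang).antisymm simGrammar_lang_subset

end CapGram
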